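/- Suppose the joint distribution of (X_n, Y_n) is Gaussian on ℝ^m × ℝ^k with means a_n = E X_n, b_n = E Y_n and cross-covariances r_n^{i,j} = cov(X_n^{(i)}, Y_n^{(j)}). Then the following are equivalent: (1) the sequences (P_{X_n}), (P_{Y_n}) are tight and (X_n, Y_n) satisfy AI-1; (2) the sequences (a_n), (b_n), (E|X_n|²), (E|Y_n|²) are bounded and r_n^{i,j} → 0 for all 1 ≤ i ≤ m, 1 ≤ j ≤ k. -/

import Mathlib

open MeasureTheory Filter

open ProbabilityTheory Topology
open scoped BoundedContinuousFunction

section WeakConvergence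

variable {E F : Type*} [NormedAddCommGroup E] [NormedSpace ℝ E] [MeasurableSpace E] [BorelSpace E]
  [NormedAddCommGroup F] [NormedSpace ℝ F] [MeasurableSpace F] [BorelSpace F]

theorem tendsto_charFunDual {ι : Type*} {l : Filter ι} {q : ι → ProbabilityMeasure E}
    {q₀ : ProbabilityMeasure E} (hq : Tendsto q l (𝓝 q₀)) (L : StrongDual ℝ E) :
    Tendsto (fun i ↦ charFunDual (q i : Measure E) L) l (𝓝 (charFunDual (q₀ : Measure E) L)) :=
  (ProbabilityMeasure.tendsto_iff_forall_integral_rclike_tendsto ℂ).1 hq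
    (BoundedContinuousFunction.probCharDual L)

/-- For a tight sequence of laws on a product space, asymptotic factorization of the
characteristic functions forces asymptotic factorization against bounded continuous functions. -/
theorem tendsto_integral_sub_integral_prod_of_charFunDual
    [CompleteSpace E] [SecondCountableTopology E] [CompleteSpace F] [SecondCountableTopology F]
    {q : ℕ → Measure (E × F)} [∀ n, IsProbabilityMeasure (q n)]
    (hq : IsTightMeasureSet (Set.range q))
    (hchar : ∀ L, Tendsto
      (fun n ↦ charFunDual (q n) L - charFunDual ((q n).fst.prod (q n).snd) L) atTop (𝓝 0))
    (h : E × F →ᵇ ℝ) :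
    Tendsto (fun n ↦ (∫ z, h z ∂(q n)) - ∫ z, h z ∂((q n).fst.prod (q n).snd)) atTop (𝓝 0) := by
  let Q : ℕ → ProbabilityMeasure (E × F) := fun n ↦ ⟨q n, inferInstance⟩
  let R : ProbabilityMeasure (E × F) → ProbabilityMeasure (E × F) := fun μ ↦
    (μ.map measurable_fst.aemeasurable).prod (μ.map measurable_snd.aemeasurable)
  have hR : Continuous R := ProbabilityMeasure.continuous_prod.comp
    ((ProbabilityMeasure.continuous_map continuous_fst).prodMk
      (ProbabilityMeasure.continuous_map continuous_snd))
  have hcpt : IsCompact (closure (Set.range Q)) := by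
    refine isCompact_closure_of_isTightMeasureSet (hq.subset ?_)
    rintro _ ⟨_, ⟨n, rfl⟩, rfl⟩
    exact ⟨n, rfl⟩
  rw [tendsto_iff_ultrafilter]
  intro U hU
  obtain ⟨Q₀, -, hQ₀⟩ := hcpt.ultrafilter_le_nhds (U.map Q) (by
    rw [le_principal_iff]
    exact Filter.mem_map.2 (Filter.univ_mem' fun n ↦ subset_closure ⟨n, rfl⟩))
  have hQ : Tendsto Q U (𝓝 Q₀) := hQ₀
  have hRQ : Tendsto (fun n ↦ R (Q n)) U (𝓝 (R Q₀)) := (hR.tendsto Q₀).comp hQ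
  have heq : (Q₀ : Measure (E × F)) = R Q₀ := by
    refine Measure.ext_of_charFunDual (funext fun L ↦ sub_eq_zero.1 ?_)
    exact tendsto_nhds_unique ((tendsto_charFunDual hQ L).sub (tendsto_charFunDual hRQ L))
      ((hchar L).mono_left hU)
  have hlim := (ProbabilityMeasure.tendsto_iff_forall_integral_tendsto.1 hQ h).sub
    (ProbabilityMeasure.tendsto_iff_forall_integral_tendsto.1 hRQ h)
  rw [← heq, sub_self] at hlim
  exact hlim

/-- Asymptotic equality against bounded uniformly continuous functions gives asymptotic equality of
characteristic functions. -/
theorem tendsto_charFunDual_sub_charFunDual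
    {q r : ℕ → Measure E} [∀ n, IsProbabilityMeasure (q n)] [∀ n, IsProbabilityMeasure (r n)]
    (hq : ∀ h : E → ℝ, UniformContinuous h → (∃ C, ∀ z, |h z| ≤ C) →
      Tendsto (fun n ↦ (∫ z, h z ∂(q n)) - ∫ z, h z ∂(r n)) atTop (𝓝 0))
    (L : StrongDual ℝ E) :
    Tendsto (fun n ↦ charFunDual (q n) L - charFunDual (r n) L) atTop (𝓝 0) := by
  have hdecomp (μ : Measure E) [IsProbabilityMeasure μ] :
      charFunDual μ L =
        ((∫ z, Real.cos (L z) ∂μ : ℝ) : ℂ) + ((∫ z, Real.sin (L z) ∂μ : ℝ) : ℂ) * Complex.I := by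
    have hint : Integrable (fun z ↦ Complex.exp (L z * Complex.I)) μ :=
      (integrable_const (1 : ℝ)).mono' (by fun_prop)
        (ae_of_all _ fun z ↦ (Complex.norm_exp_ofReal_mul_I _).le)
    rw [charFunDual_apply, ← integral_re_add_im hint]
    simp [Complex.exp_ofReal_mul_I_re, Complex.exp_ofReal_mul_I_im]
  have hcos := hq (fun z ↦ Real.cos (L z))
    (Real.lipschitzWith_cos.uniformContinuous.comp L.uniformContinuous)
    ⟨1, fun z ↦ Real.abs_cos_le_one _⟩
  have hsin := hq (fun z ↦ Real.sin (L z))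
    (Real.lipschitzWith_sin.uniformContinuous.comp L.uniformContinuous)
    ⟨1, fun z ↦ Real.abs_sin_le_one _⟩
  have := ((Complex.continuous_ofReal.tendsto 0).comp hcos).add
    (((Complex.continuous_ofReal.tendsto 0).comp hsin).mul_const Complex.I)
  simp only [Complex.ofReal_zero, zero_mul, add_zero] at this
  refine this.congr fun n ↦ ?_
  rw [hdecomp, hdecomp]
  simp only [Function.comp_apply, Complex.ofReal_sub]
  ring

end WeakConvergence

section Gaussian

variable {Ω : Type*} [MeasurableSpace Ω] {P : Measure Ω}

theorem ProbabilityTheory.HasGaussianLaw.integral_cexp_mul_I {U : Ω → ℝ} (hU : HasGaussianLaw U P) :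
    ∫ ω, Complex.exp (U ω * Complex.I) ∂P =
      Complex.exp (((∫ ω, U ω ∂P : ℝ) : ℂ) * Complex.I - (Var[U; P] : ℝ) / 2) := by
  have h := hU.charFunDual_map_eq (.id ℝ ℝ)
  rw [charFunDual_apply, integral_map hU.aemeasurable (by fun_prop)] at h
  simpa using h

theorem norm_charFunDual_sub_charFunDual_prod
    {E F : Type*} [NormedAddCommGroup E] [NormedSpace ℝ E] [MeasurableSpace E] [BorelSpace E]
    [SecondCountableTopology E]
    [NormedAddCommGroup F] [NormedSpace ℝ F] [MeasurableSpace F] [BorelSpace F]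
    [SecondCountableTopology F] {X : Ω → E} {Y : Ω → F}
    (hXY : HasGaussianLaw (fun ω ↦ (X ω, Y ω)) P) (L : StrongDual ℝ E) (M : StrongDual ℝ F) :
    ‖charFunDual (P.map fun ω ↦ (X ω, Y ω)) (L.coprod M)
        - charFunDual ((P.map X).prod (P.map Y)) (L.coprod M)‖
      = Real.exp (-(Var[L ∘ X; P] + Var[M ∘ Y; P]) / 2)
        * |Real.exp (-cov[L ∘ X, M ∘ Y; P]) - 1| := by
  have := hXY.isProbabilityMeasure
  have hLX : HasGaussianLaw (L ∘ X) P := hXY.fst.map L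
  have hMY : HasGaussianLaw (M ∘ Y) P := hXY.snd.map M
  have hsum : HasGaussianLaw (L ∘ X + M ∘ Y) P := by
    have := hXY.map (L.coprod M)
    exact this
  have h1 : charFunDual (P.map fun ω ↦ (X ω, Y ω)) (L.coprod M)
      = ∫ ω, Complex.exp ((L ∘ X + M ∘ Y) ω * Complex.I) ∂P := by
    rw [charFunDual_apply, integral_map hXY.aemeasurable (by fun_prop)]
    simp
  have h2 : charFunDual ((P.map X).prod (P.map Y)) (L.coprod M)
      = (∫ ω, Complex.exp ((L ∘ X) ω * Complex.I) ∂P)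
        * ∫ ω, Complex.exp ((M ∘ Y) ω * Complex.I) ∂P := by
    rw [charFunDual_prod, charFunDual_apply, charFunDual_apply,
      integral_map hXY.fst.aemeasurable (by fun_prop),
      integral_map hXY.snd.aemeasurable (by fun_prop)]
    simp
  rw [h1, h2, hsum.integral_cexp_mul_I, hLX.integral_cexp_mul_I, hMY.integral_cexp_mul_I,
    variance_add hLX.memLp_two hMY.memLp_two]
  have h3 : ∫ ω, (L ∘ X + M ∘ Y) ω ∂P = (∫ ω, (L ∘ X) ω ∂P) + ∫ ω, (M ∘ Y) ω ∂P :=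
    integral_add hLX.integrable hMY.integrable
  rw [h3]
  generalize ∫ ω, (L ∘ X) ω ∂P = a
  generalize ∫ ω, (M ∘ Y) ω ∂P = b
  generalize Var[L ∘ X; P] = v
  generalize Var[M ∘ Y; P] = w
  generalize cov[L ∘ X, M ∘ Y; P] = c
  have h4 : Complex.exp (((a + b : ℝ) : ℂ) * Complex.I - ((v + 2 * c + w : ℝ) : ℂ) / 2)
      - Complex.exp ((a : ℂ) * Complex.I - v / 2) * Complex.exp ((b : ℂ) * Complex.I - w / 2)
      = Complex.exp ((a + b : ℝ) * Complex.I) *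
        ((Real.exp (-(v + w) / 2) * (Real.exp (-c) - 1) : ℝ) : ℂ) := by
    push_cast
    rw [mul_sub, mul_sub, mul_one, ← Complex.exp_add, ← Complex.exp_add, ← Complex.exp_add,
      ← Complex.exp_add]
    congr 2 <;> ring
  rw [h4, norm_mul, Complex.norm_exp_ofReal_mul_I, one_mul, Complex.norm_real, Real.norm_eq_abs,
    abs_mul, abs_of_pos (Real.exp_pos _)]

/-- A Gaussian variable which is at most `R` in absolute value with probability at least `7 / 8`
has variance bounded in terms of `R`. -/
theorem ProbabilityTheory.HasGaussianLaw.variance_le_of_le_measureReal {U : Ω → ℝ}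
    (hU : HasGaussianLaw U P) (hm : Measurable U) {R : ℝ} (hR : 0 ≤ R)
    (h : 7 / 8 ≤ P.real {ω | |U ω| ≤ R}) : Var[U; P] ≤ 32 * (R + 1) ^ 2 := by
  have := hU.isProbabilityMeasure
  set t : ℝ := 1 / (4 * (R + 1)) with ht
  have ht0 : 0 < t := by positivity
  have htR : t * R ≤ 1 / 4 := by
    rw [ht, div_mul_eq_mul_div, div_le_div_iff₀ (by positivity) (by norm_num)]
    linarith
  have hA : MeasurableSet {ω | |U ω| ≤ R} := measurableSet_le (by fun_prop) measurable_const
  have htU : HasGaussianLaw (fun ω ↦ t * U ω) P := hU.fun_smul t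
  have hint : Integrable (fun ω ↦ Complex.exp ((t * U ω : ℝ) * Complex.I)) P :=
    (integrable_const (1 : ℝ)).mono' (by fun_prop)
      (ae_of_all _ fun z ↦ (Complex.norm_exp_ofReal_mul_I _).le)
  have hpt (ω : Ω) : ‖Complex.exp ((t * U ω : ℝ) * Complex.I) - 1‖
      ≤ 1 / 4 + {ω | |U ω| ≤ R}ᶜ.indicator (fun _ ↦ (2 : ℝ)) ω := by
    by_cases hω : |U ω| ≤ R
    · have h1 : ‖Complex.exp ((t * U ω : ℝ) * Complex.I) - 1‖ ≤ |t * U ω| := by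
        rw [mul_comm]
        exact Real.norm_exp_I_mul_ofReal_sub_one_le
      rw [abs_mul, abs_of_pos ht0] at h1
      have h2 : t * |U ω| ≤ t * R := by gcongr
      simp only [Set.indicator, Set.mem_compl_iff, Set.mem_ofPred_eq, hω, not_true_eq_false,
        if_false, add_zero]
      linarith
    · have h1 := norm_sub_le (Complex.exp ((t * U ω : ℝ) * Complex.I)) 1
      rw [Complex.norm_exp_ofReal_mul_I, norm_one] at h1
      simp only [Set.indicator, Set.mem_compl_iff, Set.mem_ofPred_eq, hω, not_false_eq_true,
        if_true]
      linarith
  have hle : ‖(∫ ω, Complex.exp ((t * U ω : ℝ) * Complex.I) ∂P) - 1‖ ≤ 1 / 2 := by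
    calc ‖(∫ ω, Complex.exp ((t * U ω : ℝ) * Complex.I) ∂P) - 1‖
        = ‖∫ ω, (Complex.exp ((t * U ω : ℝ) * Complex.I) - 1) ∂P‖ := by
          rw [integral_sub hint (integrable_const _)]; simp
      _ ≤ ∫ ω, (1 / 4 + {ω | |U ω| ≤ R}ᶜ.indicator (fun _ ↦ (2 : ℝ)) ω) ∂P :=
          norm_integral_le_of_norm_le ((integrable_const _).add
            ((integrable_const _).indicator hA.compl)) (ae_of_all _ hpt)
      _ = 1 / 4 + P.real {ω | |U ω| ≤ R}ᶜ * 2 := by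
          rw [integral_add (integrable_const _) ((integrable_const _).indicator hA.compl),
            integral_indicator_const _ hA.compl]
          simp
      _ ≤ 1 / 2 := by rw [probReal_compl_eq_one_sub hA]; linarith
  have hnorm : ‖∫ ω, Complex.exp ((t * U ω : ℝ) * Complex.I) ∂P‖
      = Real.exp (-(t ^ 2 * Var[U; P] / 2)) := by
    rw [htU.integral_cexp_mul_I, variance_const_mul, Complex.norm_exp]
    congr 1
    simp [-Complex.ofReal_pow]
  have hlow : 1 / 2 ≤ Real.exp (-(t ^ 2 * Var[U; P] / 2)) := by
    rw [← hnorm]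
    have := norm_sub_norm_le (1 : ℂ) (∫ ω, Complex.exp ((t * U ω : ℝ) * Complex.I) ∂P)
    rw [norm_sub_rev, norm_one] at this
    linarith
  have hlog : t ^ 2 * Var[U; P] / 2 ≤ 1 := by
    by_contra! hlt
    have h1 : Real.exp (-(t ^ 2 * Var[U; P] / 2)) ≤ Real.exp (-1) :=
      Real.exp_le_exp.2 (by linarith)
    have h2 := Real.exp_neg_one_lt_half
    linarith
  have hmul : t * (4 * (R + 1)) = 1 := by rw [ht]; field_simp
  have : Var[U; P] = (t ^ 2 * Var[U; P] / 2) * (32 * (R + 1) ^ 2) := by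
    linear_combination (-(t * (4 * (R + 1)) + 1) * Var[U; P]) * hmul
  rw [this]
  exact mul_le_of_le_one_left (by positivity) hlog

theorem ProbabilityTheory.HasGaussianLaw.abs_integral_le_of_le_measureReal {U : Ω → ℝ}
    (hU : HasGaussianLaw U P) (hm : Measurable U) {R : ℝ} (hR : 0 ≤ R)
    (h : 7 / 8 ≤ P.real {ω | |U ω| ≤ R}) : |∫ ω, U ω ∂P| ≤ 9 * (R + 1) := by
  have := hU.isProbabilityMeasure
  by_contra! hlt
  have hcheb := meas_ge_le_variance_div_sq hU.memLp_two (c := 8 * (R + 1)) (by positivity)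
  have hreal : P.real {ω | 8 * (R + 1) ≤ |U ω - ∫ ω, U ω ∂P|} ≤ 1 / 2 := by
    refine (ENNReal.toReal_le_of_le_ofReal
      (div_nonneg (variance_nonneg _ _) (by positivity)) hcheb).trans ?_
    rw [div_le_div_iff₀ (by positivity) (by norm_num)]
    nlinarith [hU.variance_le_of_le_measureReal hm hR h]
  have hsub : {ω | |U ω| ≤ R} ⊆ {ω | 8 * (R + 1) ≤ |U ω - ∫ ω, U ω ∂P|} := by
    intro ω hω
    have h1 := abs_sub_abs_le_abs_sub (∫ ω, U ω ∂P) (U ω)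
    rw [abs_sub_comm] at h1
    simp only [Set.mem_ofPred_eq] at hω ⊢
    linarith
  have := measureReal_mono hsub (μ := P)
  linarith

theorem tendsto_zero_of_tendsto_exp_mul_abs {v c : ℕ → ℝ} {V : ℝ} (hv : ∀ n, v n ≤ V)
    (h : Tendsto (fun n ↦ Real.exp (-v n / 2) * |Real.exp (-c n) - 1|) atTop (𝓝 0)) :
    Tendsto c atTop (𝓝 0) := by
  have h1 : Tendsto (fun n ↦ Real.exp (-c n) - 1) atTop (𝓝 0) := by
    refine squeeze_zero_norm (fun n ↦ ?_) (by simpa using h.const_mul (Real.exp (V / 2)))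
    rw [Real.norm_eq_abs, ← mul_assoc, ← Real.exp_add]
    refine le_mul_of_one_le_left (abs_nonneg _) (Real.one_le_exp ?_)
    linarith [hv n]
  have h2 : Tendsto (fun n ↦ Real.exp (-c n)) atTop (𝓝 1) := by simpa using h1.add_const 1
  simpa using (h2.log one_ne_zero).neg

theorem tendsto_cov_continuousLinearMap {ι κ : Type*} [Fintype ι] [Fintype κ]
    [IsProbabilityMeasure P] {X : ℕ → Ω → ι → ℝ} {Y : ℕ → Ω → κ → ℝ}
    (hX : ∀ n i, MemLp (fun ω ↦ X n ω i) 2 P) (hY : ∀ n j, MemLp (fun ω ↦ Y n ω j) 2 P)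
    (h : ∀ i j, Tendsto (fun n ↦ cov[fun ω ↦ X n ω i, fun ω ↦ Y n ω j; P]) atTop (𝓝 0))
    (L : StrongDual ℝ (ι → ℝ)) (M : StrongDual ℝ (κ → ℝ)) :
    Tendsto (fun n ↦ cov[L ∘ X n, M ∘ Y n; P]) atTop (𝓝 0) := by
  classical
  have hL (x : ι → ℝ) : L x = ∑ i, x i * L (fun j ↦ if i = j then 1 else 0) :=
    L.toLinearMap.pi_apply_eq_sum_univ x
  have hM (x : κ → ℝ) : M x = ∑ i, x i * M (fun j ↦ if i = j then 1 else 0) :=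
    M.toLinearMap.pi_apply_eq_sum_univ x
  have hcov (n : ℕ) : cov[L ∘ X n, M ∘ Y n; P] = ∑ i, ∑ j,
      cov[fun ω ↦ X n ω i, fun ω ↦ Y n ω j; P] * M (fun j' ↦ if j = j' then 1 else 0)
        * L (fun j ↦ if i = j then 1 else 0) := by
    rw [show L ∘ X n = fun ω ↦ ∑ i, X n ω i * L (fun j ↦ if i = j then 1 else 0) from
        funext fun ω ↦ hL (X n ω),
      show M ∘ Y n = fun ω ↦ ∑ i, Y n ω i * M (fun j ↦ if i = j then 1 else 0) from
        funext fun ω ↦ hM (Y n ω),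
      covariance_fun_sum_fun_sum (fun i ↦ (hX n i).mul_const _) fun j ↦ (hY n j).mul_const _]
    simp_rw [covariance_mul_const_left, covariance_mul_const_right]
  simp_rw [hcov]
  have := tendsto_finsetSum Finset.univ fun i _ ↦ tendsto_finsetSum Finset.univ fun j _ ↦
    ((h i j).mul_const (M (fun j' ↦ if j = j' then 1 else 0))).mul_const
      (L (fun j ↦ if i = j then 1 else 0))
  simpa using this

theorem isTightMeasureSet_range_map {E : Type*} [TopologicalSpace E] [T2Space E]
    [MeasurableSpace E] [BorelSpace E] [IsProbabilityMeasure P] {X : ℕ → Ω → E}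
    (hm : ∀ n, Measurable (X n))
    (h : ∀ ε : ℝ, 0 < ε → ∃ K : Set E, IsCompact K ∧
      ∀ n, (P {ω | X n ω ∈ K}).toReal ≥ 1 - ε) :
    IsTightMeasureSet (Set.range fun n ↦ P.map (X n)) := by
  rw [isTightMeasureSet_iff_exists_isCompact_measure_compl_le]
  intro ε hε
  obtain ⟨δ, hδ, hδε⟩ := ENNReal.lt_iff_exists_nnreal_btwn.1 hε
  obtain ⟨K, hK, hKP⟩ := h δ (by exact_mod_cast hδ)
  refine ⟨K, hK, ?_⟩
  rintro _ ⟨n, rfl⟩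
  have hle : P.real (X n ⁻¹' K)ᶜ ≤ δ := by
    rw [probReal_compl_eq_one_sub (hm n hK.measurableSet)]
    linarith [hKP n, show P.real (X n ⁻¹' K) = (P {ω | X n ω ∈ K}).toReal from rfl]
  rw [Measure.map_apply (hm n) hK.measurableSet.compl, Set.preimage_compl]
  refine le_trans ?_ hδε.le
  rw [← ofReal_measureReal, ← ENNReal.ofReal_coe_nnreal]
  exact ENNReal.ofReal_le_ofReal hle

theorem exists_isCompact_of_integral_sum_sq_le {ι : Type*} [Fintype ι] [IsProbabilityMeasure P]
    {X : ℕ → Ω → ι → ℝ} (hm : ∀ n, Measurable (X n))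
    (hX : ∀ n i, MemLp (fun ω ↦ X n ω i) 2 P) {C : ℝ}
    (hC : ∀ n, ∫ ω, ∑ i, X n ω i ^ 2 ∂P ≤ C) (ε : ℝ) (hε : 0 < ε) :
    ∃ K : Set (ι → ℝ), IsCompact K ∧ ∀ n, (P {ω | X n ω ∈ K}).toReal ≥ 1 - ε := by
  have hC0 : 0 ≤ C := (integral_nonneg fun ω ↦ by positivity).trans (hC 0)
  set R : ℝ := C / ε + 1 with hR
  have hR1 : 1 ≤ R := by rw [hR]; linarith [div_nonneg hC0 hε.le]
  have hRε : C ≤ R * ε := by rw [hR, add_mul, div_mul_cancel₀ _ hε.ne']; linarith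
  refine ⟨Metric.closedBall 0 R, isCompact_closedBall _ _, fun n ↦ ?_⟩
  have hmeas : MeasurableSet {ω | X n ω ∈ Metric.closedBall 0 R} :=
    hm n measurableSet_closedBall
  have hmarkov := mul_meas_ge_le_integral_of_nonneg (μ := P)
    (ae_of_all _ fun ω ↦ (by positivity : 0 ≤ ∑ i, X n ω i ^ 2))
    (integrable_finsetSum _ fun i _ ↦ (hX n i).integrable_sq) R
  have hsub : {ω | X n ω ∈ Metric.closedBall 0 R}ᶜ ⊆ {ω | R ≤ ∑ i, X n ω i ^ 2} := by
    intro ω hω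
    simp only [Set.mem_compl_iff, Set.mem_ofPred_eq, mem_closedBall_zero_iff] at hω ⊢
    rw [pi_norm_le_iff_of_nonneg (by linarith)] at hω
    push Not at hω
    obtain ⟨i, hi⟩ := hω
    calc R ≤ R ^ 2 := by nlinarith
      _ ≤ ‖X n ω i‖ ^ 2 := by gcongr
      _ = X n ω i ^ 2 := by rw [Real.norm_eq_abs, sq_abs]
      _ ≤ ∑ i, X n ω i ^ 2 :=
        Finset.single_le_sum (f := fun i ↦ X n ω i ^ 2) (fun _ _ ↦ sq_nonneg _)
          (Finset.mem_univ i)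
  have hmono := measureReal_mono hsub (μ := P)
  rw [probReal_compl_eq_one_sub hmeas] at hmono
  have : P.real {ω | R ≤ ∑ i, X n ω i ^ 2} ≤ ε := by
    by_contra! hlt
    nlinarith [hC n]
  change P.real _ ≥ _
  linarith

theorem exists_bound_of_tight {ι : Type*} [Fintype ι] {X : ℕ → Ω → ι → ℝ}
    (hm : ∀ n, Measurable (X n)) (hX : ∀ n i, HasGaussianLaw (fun ω ↦ X n ω i) P)
    (h : ∀ ε : ℝ, 0 < ε → ∃ K : Set (ι → ℝ), IsCompact K ∧
      ∀ n, (P {ω | X n ω ∈ K}).toReal ≥ 1 - ε) :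
    ∃ C : ℝ, 0 ≤ C ∧ ∀ n i, |∫ ω, X n ω i ∂P| ≤ C ∧ Var[fun ω ↦ X n ω i; P] ≤ C := by
  obtain ⟨K, hK, hKP⟩ := h (1 / 8) (by norm_num)
  obtain ⟨R, hR, hKR⟩ := hK.isBounded.exists_pos_norm_le
  refine ⟨9 * (R + 1) + 32 * (R + 1) ^ 2, by positivity, fun n i ↦ ?_⟩
  have := (hX n i).isProbabilityMeasure
  have hi : Measurable fun ω ↦ X n ω i := (measurable_pi_apply i).comp (hm n)
  have hsub : {ω | X n ω ∈ K} ⊆ {ω | |X n ω i| ≤ R} := fun ω hω ↦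
    (norm_le_pi_norm (X n ω) i).trans (hKR _ hω)
  have hP : 7 / 8 ≤ P.real {ω | |X n ω i| ≤ R} := by
    have h1 := measureReal_mono hsub (μ := P)
    have h2 : P.real {ω | X n ω ∈ K} ≥ 1 - 1 / 8 := hKP n
    linarith
  have h1 := (hX n i).abs_integral_le_of_le_measureReal hi hR.le hP
  have h2 := (hX n i).variance_le_of_le_measureReal hi hR.le hP
  exact ⟨h1.trans (by nlinarith), h2.trans (by nlinarith)⟩

theorem integral_sum_sq_le {ι : Type*} [Fintype ι] [IsProbabilityMeasure P] {X : Ω → ι → ℝ}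
    (hX : ∀ i, MemLp (fun ω ↦ X ω i) 2 P) {C : ℝ}
    (h : ∀ i, |∫ ω, X ω i ∂P| ≤ C ∧ Var[fun ω ↦ X ω i; P] ≤ C) :
    ∫ ω, ∑ i, X ω i ^ 2 ∂P ≤ Fintype.card ι * (C + C ^ 2) := by
  rw [integral_finsetSum _ fun i _ ↦ (hX i).integrable_sq]
  refine (Finset.sum_le_card_nsmul _ _ (C + C ^ 2) fun i _ ↦ ?_).trans (by simp [mul_add])
  have h1 := variance_eq_sub (hX i)
  have h2 : (∫ ω, X ω i ∂P) ^ 2 ≤ C ^ 2 := sq_le_sq' (abs_le.1 (h i).1).1 (abs_le.1 (h i).1).2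
  simp only [Pi.pow_apply] at h1
  linarith [(h i).2]

end Gaussian

theorem stmt_18 {Ω : Type*} [MeasurableSpace Ω]
    (P : Measure Ω) [IsProbabilityMeasure P] (m k : ℕ)
    (X : ℕ → Ω → (Fin m → ℝ)) (Y : ℕ → Ω → (Fin k → ℝ))
    (hX : ∀ n, Measurable (X n)) (hY : ∀ n, Measurable (Y n))
    -- (X n, Y n) is jointly Gaussian: every linear functional has a Gaussian law
    (hGauss : ∀ n, ∀ t : Fin m → ℝ, ∀ s : Fin k → ℝ,
      ∃ (μ : ℝ) (v : NNReal),
        P.map (fun ω => ∑ i, t i * X n ω i + ∑ j, s j * Y n ω j)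
          = ProbabilityTheory.gaussianReal μ v) :
    -- (1) tightness of the marginal laws together with AI-1
    ((∀ ε : ℝ, 0 < ε → ∃ K : Set (Fin m → ℝ), IsCompact K ∧
        ∀ n, (P {ω | X n ω ∈ K}).toReal ≥ 1 - ε)
      ∧ (∀ ε : ℝ, 0 < ε → ∃ K : Set (Fin k → ℝ), IsCompact K ∧
        ∀ n, (P {ω | Y n ω ∈ K}).toReal ≥ 1 - ε)
      ∧ (∀ h : (Fin m → ℝ) × (Fin k → ℝ) → ℝ,
        UniformContinuous h → (∃ C, ∀ z, |h z| ≤ C) →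
        Tendsto (fun n =>
            (∫ ω, h (X n ω, Y n ω) ∂P)
              - ∫ z, h z ∂((P.map (X n)).prod (P.map (Y n))))
          atTop (nhds 0)))
    ↔ -- (2) bounded means and second moments, vanishing cross-covariances
    ((∃ C : ℝ, ∀ n, ∀ i, |∫ ω, X n ω i ∂P| ≤ C)
      ∧ (∃ C : ℝ, ∀ n, ∀ j, |∫ ω, Y n ω j ∂P| ≤ C)
      ∧ (∃ C : ℝ, ∀ n, (∫ ω, ∑ i, (X n ω i) ^ 2 ∂P) ≤ C)
      ∧ (∃ C : ℝ, ∀ n, (∫ ω, ∑ j, (Y n ω j) ^ 2 ∂P) ≤ C)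
      ∧ (∀ i : Fin m, ∀ j : Fin k,
        Tendsto (fun n =>
            (∫ ω, X n ω i * Y n ω j ∂P)
              - (∫ ω, X n ω i ∂P) * (∫ ω, Y n ω j ∂P))
          atTop (nhds 0))) := by
  have hXY (n : ℕ) : HasGaussianLaw (fun ω ↦ (X n ω, Y n ω)) P := by
    refine ⟨isGaussian_of_map_eq_gaussianReal fun L ↦ ?_⟩
    obtain ⟨μ, v, h⟩ := hGauss n (fun i ↦ L (fun j ↦ if i = j then 1 else 0, 0))
      (fun i ↦ L (0, fun j ↦ if i = j then 1 else 0))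
    refine ⟨μ, v, ?_⟩
    rw [← h, Measure.map_map L.continuous.measurable ((hX n).prodMk (hY n))]
    congr 1
    ext ω
    have h1 := (L.comp (.inl ℝ (Fin m → ℝ) (Fin k → ℝ))).toLinearMap.pi_apply_eq_sum_univ (X n ω)
    have h2 := (L.comp (.inr ℝ (Fin m → ℝ) (Fin k → ℝ))).toLinearMap.pi_apply_eq_sum_univ (Y n ω)
    have h3 := L.comp_inl_add_comp_inr (X n ω, Y n ω)
    rw [Function.comp_apply, ← h3]
    refine congrArg₂ (· + ·) (h1.trans ?_) (h2.trans ?_) <;>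
      exact Finset.sum_congr rfl fun i _ ↦ mul_comm _ _
  have hXi (n : ℕ) (i : Fin m) : HasGaussianLaw (fun ω ↦ X n ω i) P :=
    (hXY n).fst.map (.proj i)
  have hYj (n : ℕ) (j : Fin k) : HasGaussianLaw (fun ω ↦ Y n ω j) P :=
    (hXY n).snd.map (.proj j)
  have hcov (n : ℕ) (i : Fin m) (j : Fin k) : cov[fun ω ↦ X n ω i, fun ω ↦ Y n ω j; P]
      = (∫ ω, X n ω i * Y n ω j ∂P) - (∫ ω, X n ω i ∂P) * (∫ ω, Y n ω j ∂P) :=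
    covariance_eq_sub (hXi n i).memLp_two (hYj n j).memLp_two
  simp_rw [← hcov]
  have hmXY (n : ℕ) : Measurable fun ω ↦ (X n ω, Y n ω) := (hX n).prodMk (hY n)
  have hprob (n : ℕ) : IsProbabilityMeasure (P.map fun ω ↦ (X n ω, Y n ω)) :=
    Measure.isProbabilityMeasure_map (hmXY n).aemeasurable
  have hprobX (n : ℕ) : IsProbabilityMeasure (P.map (X n)) :=
    Measure.isProbabilityMeasure_map (hX n).aemeasurable
  have hprobY (n : ℕ) : IsProbabilityMeasure (P.map (Y n)) :=
    Measure.isProbabilityMeasure_map (hY n).aemeasurable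
  have hmap (h : (Fin m → ℝ) × (Fin k → ℝ) → ℝ) (hc : Continuous h) (n : ℕ) :
      ∫ ω, h (X n ω, Y n ω) ∂P = ∫ z, h z ∂(P.map fun ω ↦ (X n ω, Y n ω)) :=
    (integral_map (hmXY n).aemeasurable hc.aestronglyMeasurable).symm
  have hfst (n : ℕ) : (P.map fun ω ↦ (X n ω, Y n ω)).fst = P.map (X n) :=
    Measure.fst_map_prodMk (hY n)
  have hsnd (n : ℕ) : (P.map fun ω ↦ (X n ω, Y n ω)).snd = P.map (Y n) :=
    Measure.snd_map_prodMk (hX n)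
  constructor
  · rintro ⟨htX, htY, hAI⟩
    obtain ⟨C, hC0, hC⟩ := exists_bound_of_tight hX hXi htX
    obtain ⟨D, hD0, hD⟩ := exists_bound_of_tight hY hYj htY
    refine ⟨⟨C, fun n i ↦ (hC n i).1⟩, ⟨D, fun n j ↦ (hD n j).1⟩,
      ⟨_, fun n ↦ integral_sum_sq_le (fun i ↦ (hXi n i).memLp_two) (hC n)⟩,
      ⟨_, fun n ↦ integral_sum_sq_le (fun j ↦ (hYj n j).memLp_two) (hD n)⟩, fun i j ↦ ?_⟩
    have hchar := (tendsto_charFunDual_sub_charFunDual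
      (q := fun n ↦ P.map fun ω ↦ (X n ω, Y n ω)) (r := fun n ↦ (P.map (X n)).prod (P.map (Y n)))
      (fun h hu hb ↦ by simpa only [hmap h hu.continuous] using hAI h hu hb)
      ((ContinuousLinearMap.proj i).coprod (ContinuousLinearMap.proj j))).norm
    simp_rw [norm_charFunDual_sub_charFunDual_prod (hXY _), norm_zero] at hchar
    exact tendsto_zero_of_tendsto_exp_mul_abs
      (fun n ↦ add_le_add (hC n i).2 (hD n j).2) hchar
  · rintro ⟨-, -, ⟨C, hC⟩, ⟨D, hD⟩, hr⟩
    have htX := exists_isCompact_of_integral_sum_sq_le hX (fun n i ↦ (hXi n i).memLp_two) hC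
    have htY := exists_isCompact_of_integral_sum_sq_le hY (fun n j ↦ (hYj n j).memLp_two) hD
    refine ⟨htX, htY, ?_⟩
    rintro h hu ⟨B, hB⟩
    have htight : IsTightMeasureSet (Set.range fun n ↦ P.map fun ω ↦ (X n ω, Y n ω)) := by
      refine .prodMk ?_ ?_ <;> rw [← Set.range_comp]
      · simpa only [Function.comp_def, hfst] using isTightMeasureSet_range_map hX htX
      · simpa only [Function.comp_def, hsnd] using isTightMeasureSet_range_map hY htY
    have hlim := tendsto_integral_sub_integral_prod_of_charFunDual htight (fun L ↦ ?_)
      (BoundedContinuousFunction.ofNormedAddCommGroup h hu.continuous B hB)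
    · simpa only [hmap h hu.continuous, hfst, hsnd,
        BoundedContinuousFunction.coe_ofNormedAddCommGroup] using hlim
    rw [← L.coprod_comp_inl_inr, tendsto_zero_iff_norm_tendsto_zero]
    simp_rw [hfst, hsnd, norm_charFunDual_sub_charFunDual_prod (hXY _)]
    have hc := tendsto_cov_continuousLinearMap (fun n i ↦ (hXi n i).memLp_two)
      (fun n j ↦ (hYj n j).memLp_two) hr (L.comp (.inl ℝ _ _)) (L.comp (.inr ℝ _ _))
    refine squeeze_zero (fun n ↦ by positivity) (fun n ↦ mul_le_of_le_one_left (abs_nonneg _) ?_)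
      (by simpa using ((hc.neg.rexp).sub_const 1).abs)
    rw [Real.exp_le_one_iff]
    linarith [variance_nonneg (L.comp (.inl ℝ _ _) ∘ X n) P,
      variance_nonneg (L.comp (.inr ℝ _ _) ∘ Y n) P]
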